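/- Soundness of the trace decider: for every list of external commands tr and valid state σ ≠ Wrong, if is_trace spec tr σ = true, then tr is generated by spec from σ, i.e., the sequence of external commands executed while evaluating spec from σ (restarting spec in the resulting state each time evaluation reaches Skip, for as long as commands of tr remain) equals tr. -/

import Mathlib

/-- Colors of items (and `empty` for an empty bay). -/
inductive Color
  | empty | red | white | blue
deriving DecidableEq, Repr

/-- The high-bay warehouse: a record of nine bays, each holding a color. -/
structure Bays where
  bay1 : Color
  bay2 : Color
  bay3 : Color
  bay4 : Color
  bay5 : Color
  bay6 : Color
  bay7 : Color
  bay8 : Color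
  bay9 : Color
deriving DecidableEq, Repr

/-- `bf b n` returns the color of bay `n` (for `1 ≤ n ≤ 9`). -/
def bf (b : Bays) : ℕ → Color
  | 1 => b.bay1
  | 2 => b.bay2
  | 3 => b.bay3
  | 4 => b.bay4
  | 5 => b.bay5
  | 6 => b.bay6
  | 7 => b.bay7
  | 8 => b.bay8
  | 9 => b.bay9
  | _ => Color.empty

/-- Update bay `n` to hold color `c`. -/
def setBay (b : Bays) (n : ℕ) (c : Color) : Bays :=
  match n with
  | 1 => { b with bay1 := c }
  | 2 => { b with bay2 := c }
  | 3 => { b with bay3 := c }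
  | 4 => { b with bay4 := c }
  | 5 => { b with bay5 := c }
  | 6 => { b with bay6 := c }
  | 7 => { b with bay7 := c }
  | 8 => { b with bay8 := c }
  | 9 => { b with bay9 := c }
  | _ => b

/-- `findColor c n b` returns the least index `m` with `n ≤ m ≤ 9` and `bf b m = c`,
or `none` if no such index exists. -/
def findColor (c : Color) (n : ℕ) (b : Bays) : Option ℕ :=
  if _h : n ≤ 9 then
    if bf b n = c then some n else findColor c (n + 1) b
  else none
termination_by 10 - n
decreasing_by omega

/-- User inputs: a request to retrieve or store an item of a given color. -/
inductive Input
  | RetrieveRequest (c : Color)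
  | StoreRequest (c : Color)
deriving DecidableEq, Repr

/-- The color requested by an input. -/
def requestedColor : Input → Color
  | .RetrieveRequest c => c
  | .StoreRequest c => c

/-- A state is either a valid state `⟨bays, input⟩` or the error state `Wrong`. -/
inductive State
  | Sigma (b : Bays) (i : Input)
  | Wrong
deriving DecidableEq, Repr

/-- External commands (RPCs). -/
inductive ExtCom
  | IsFull | NotFull | HasColor | DoesNotHaveColor
  | Store (c : Color)
  | Retrieve (c : Color)
deriving DecidableEq, Repr

/-- Atomic propositions. -/
inductive AP
  | APHasStoreRequest | APHasRetrieveRequest | APBaysFull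
  | APRequestRed | APRequestWhite | APRequestBlue
  | APContainsRed | APContainsWhite | APContainsBlue
deriving DecidableEq, Repr

/-- Internal commands of the DSL. -/
inductive IntCom
  | Skip
  | Seq (t1 t2 : IntCom)
  | If (p : AP) (t1 t2 : IntCom)
  | Ext (e : ExtCom)
deriving DecidableEq, Repr

/-- All nine bays are nonempty. -/
def baysFullB (b : Bays) : Bool :=
  (List.range' 1 9).all fun n => !(bf b n == Color.empty)

/-- Some bay holds color `c`. -/
def containsC (b : Bays) (c : Color) : Bool :=
  (List.range' 1 9).any fun n => bf b n == c

/-- Evaluation of an atomic proposition in a valid state `⟨b, i⟩`. -/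
def evalAP (p : AP) (b : Bays) (i : Input) : Bool :=
  match p with
  | .APHasStoreRequest => (match i with | .StoreRequest _ => true | _ => false)
  | .APHasRetrieveRequest => (match i with | .RetrieveRequest _ => true | _ => false)
  | .APBaysFull => baysFullB b
  | .APRequestRed => requestedColor i = Color.red
  | .APRequestWhite => requestedColor i = Color.white
  | .APRequestBlue => requestedColor i = Color.blue
  | .APContainsRed => containsC b Color.red
  | .APContainsWhite => containsC b Color.white
  | .APContainsBlue => containsC b Color.blue

/-- Evaluation of an atomic proposition in a state (no proposition holds at `Wrong`). -/
def evalAtomicProp (p : AP) : State → Bool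
  | .Sigma b i => evalAP p b i
  | .Wrong => false

/-- The labeling function `L : State → 2^AP`. -/
def labelFn (st : State) : Set AP := {p | evalAtomicProp p st = true}

/-- The atomic proposition `APContains⟨c⟩` for `c ∈ {red, white, blue}`. -/
def containsAP : Color → AP
  | .red => AP.APContainsRed
  | .white => AP.APContainsWhite
  | .blue => AP.APContainsBlue
  | .empty => AP.APContainsRed  -- irrelevant: only used for c ∈ {red, white, blue}

/-- The small-step semantics `→_EC` of external commands, as a function. -/
def stepEC (e : ExtCom) (st : State) : State :=
  match st with
  | .Wrong => .Wrong
  | .Sigma b i =>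
    match e with
    | .IsFull => if baysFullB b then st else .Wrong
    | .NotFull => if baysFullB b then .Wrong else st
    | .HasColor => if containsC b (requestedColor i) then st else .Wrong
    | .DoesNotHaveColor => if containsC b (requestedColor i) then .Wrong else st
    | .Store c =>
      match findColor Color.empty 1 b with
      | some n => .Sigma (setBay b n c) i
      | none => .Wrong
    | .Retrieve c =>
      match findColor c 1 b with
      | some n => .Sigma (setBay b n Color.empty) i
      | none => .Wrong

/-- The labeled small-step semantics of internal commands: a step carries
`some e` when it executes the external command `e`, and `none` otherwise. -/
inductive StepL : IntCom × State → Option ExtCom → IntCom × State → Prop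
  | ext (e : ExtCom) (st : State) :
      StepL (.Ext e, st) (some e) (.Skip, stepEC e st)
  | seq_skip (t : IntCom) (st : State) :
      StepL (.Seq .Skip t, st) none (t, st)
  | seq_step {t1 t1' t2 : IntCom} {st st' : State} {l : Option ExtCom} :
      StepL (t1, st) l (t1', st') →
      StepL (.Seq t1 t2, st) l (.Seq t1' t2, st')
  | if_true {p : AP} {t1 t2 : IntCom} {st : State} :
      evalAtomicProp p st = true → StepL (.If p t1 t2, st) none (t1, st)
  | if_false {p : AP} {t1 t2 : IntCom} {st : State} :
      evalAtomicProp p st = false → StepL (.If p t1 t2, st) none (t2, st)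

/-- The small-step semantics `→_IC` of internal commands. -/
def StepIC (c c' : IntCom × State) : Prop := ∃ l, StepL c l c'

/-- `⟨t, σ⟩ ↝ ψ`: evaluation of `t` from `σ` reaches `⟨Skip, ψ⟩`. -/
def Evaluates (t : IntCom) (σ ψ : State) : Prop :=
  Relation.ReflTransGen StepIC (t, σ) (IntCom.Skip, ψ)

/-- `EmitsTo c tr c'`: configuration `c` multi-steps to `c'` executing exactly the
external commands of `tr`, in order. -/
inductive EmitsTo : IntCom × State → List ExtCom → IntCom × State → Prop
  | refl (c : IntCom × State) : EmitsTo c [] c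
  | step {c c' c'' : IntCom × State} {l : Option ExtCom} {tr : List ExtCom} :
      StepL c l c' → EmitsTo c' tr c'' → EmitsTo c (l.toList ++ tr) c''

/-- The protocol term `spec`. -/
def spec : IntCom :=
  .If .APHasStoreRequest
    (.If .APBaysFull (.Ext .IsFull)
      (.Seq (.Ext .NotFull)
        (.If .APRequestRed (.Ext (.Store .red))
          (.If .APRequestWhite (.Ext (.Store .white))
            (.If .APRequestBlue (.Ext (.Store .blue)) .Skip)))))
    (.If .APHasRetrieveRequest
      (.If .APRequestRed
        (.If .APContainsRed (.Seq (.Ext .HasColor) (.Ext (.Retrieve .red)))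
          (.Ext .DoesNotHaveColor))
        (.If .APRequestWhite
          (.If .APContainsWhite (.Seq (.Ext .HasColor) (.Ext (.Retrieve .white)))
            (.Ext .DoesNotHaveColor))
          (.If .APRequestBlue
            (.If .APContainsBlue (.Seq (.Ext .HasColor) (.Ext (.Retrieve .blue)))
              (.Ext .DoesNotHaveColor))
            .Skip)))
      .Skip)

/-- `Generates t σ tr`: the trace `tr` is generated by evaluating `t` from `σ`,
restarting `spec` in the resulting state whenever evaluation reaches `Skip`
(for as long as commands of `tr` remain). -/
inductive Generates : IntCom → State → List ExtCom → Prop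
  | nil (t : IntCom) (σ : State) : Generates t σ []
  | emit {t t' : IntCom} {σ σ' : State} {e : ExtCom} {tr : List ExtCom} :
      EmitsTo (t, σ) [e] (t', σ') → Generates t' σ' tr → Generates t σ (e :: tr)
  | restart {t : IntCom} {σ σ' : State} {tr : List ExtCom} :
      EmitsTo (t, σ) [] (.Skip, σ') → Generates spec σ' tr → Generates t σ tr

/-- Execute a list of external commands from a state. -/
def runTrace (st : State) : List ExtCom → State
  | [] => st
  | e :: tr => runTrace (stepEC e st) tr

/-- Evaluate an internal command from a state up to (and including) the next
external command, returning that command (or `none` if evaluation reaches `Skip`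
without executing one), the remaining internal command (or `none`), and the
resulting state. -/
def evalUntilNextCom (st : State) : IntCom → Option ExtCom × Option IntCom × State
  | .Skip => (none, none, st)
  | .Ext e => (some e, none, stepEC e st)
  | .Seq t1 t2 =>
    match evalUntilNextCom st t1 with
    | (none, _, st') => evalUntilNextCom st' t2
    | (some e, none, st') => (some e, some t2, st')
    | (some e, some t1', st') => (some e, some (.Seq t1' t2), st')
  | .If p t1 t2 => if evalAtomicProp p st then evalUntilNextCom st t1 else evalUntilNextCom st t2

/-- The trace decider. -/
def isTrace (t : IntCom) (tr : List ExtCom) (st : State) : Bool :=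
  match tr with
  | [] => true
  | com :: tr' =>
    match evalUntilNextCom st t with
    | (none, _, _) => false
    | (some com', none, st') => com = com' && isTrace spec tr' st'
    | (some com', some t', st') => com = com' && isTrace t' tr' st'
termination_by tr.length
decreasing_by all_goals simp

theorem EmitsTo.trans {c c' c'' : IntCom × State} {tr tr' : List ExtCom}
    (h : EmitsTo c tr c') (h' : EmitsTo c' tr' c'') : EmitsTo c (tr ++ tr') c'' := by
  induction h with
  | refl => exact h'
  | step hs _ ih => rw [List.append_assoc]; exact .step hs (ih h')

theorem EmitsTo.silent_step {c c' c'' : IntCom × State} {tr : List ExtCom}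
    (hs : StepL c none c') (h : EmitsTo c' tr c'') : EmitsTo c tr c'' :=
  .step hs h

theorem EmitsTo.seq {c c' : IntCom × State} {tr : List ExtCom} (t : IntCom)
    (h : EmitsTo c tr c') : EmitsTo (.Seq c.1 t, c.2) tr (.Seq c'.1 t, c'.2) := by
  induction h with
  | refl => exact .refl _
  | step hs _ ih => exact .step (.seq_step hs) ih

/-- Once the first component has finished, a sequence silently continues with the second. -/
theorem EmitsTo.seq_of_skip {t₁ t₂ : IntCom} {σ σ' : State} {tr : List ExtCom}
    (h : EmitsTo (t₁, σ) tr (.Skip, σ')) : EmitsTo (.Seq t₁ t₂, σ) tr (t₂, σ') := by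
  simpa using (h.seq t₂).trans (.silent_step (.seq_skip t₂ σ') (.refl _))

/-- `evalUntilNextCom` follows the labeled small-step semantics; an absent remaining command
stands for `Skip`, and nothing remains when no external command was executed. -/
theorem evalUntilNextCom_emitsTo {t : IntCom} {σ σ' : State} {o : Option ExtCom}
    {r : Option IntCom} (h : evalUntilNextCom σ t = (o, r, σ')) :
    EmitsTo (t, σ) o.toList (r.getD .Skip, σ') ∧ (o = none → r = none) := by
  induction t generalizing σ σ' o r with
  | Skip =>
    cases h
    exact ⟨.refl _, fun _ => rfl⟩
  | Ext e =>
    cases h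
    exact ⟨.step (.ext e σ) (.refl _), nofun⟩
  | If p t₁ t₂ ih₁ ih₂ =>
    rw [evalUntilNextCom] at h
    split at h
    next hp => exact (ih₁ h).imp_left (.silent_step (.if_true hp))
    next hp => exact (ih₂ h).imp_left (.silent_step (.if_false (by simpa using hp)))
  | Seq t₁ t₂ ih₁ ih₂ =>
    rw [evalUntilNextCom] at h
    split at h
    next r₁ σ₁ h₁ =>
      obtain ⟨hem, hnone⟩ := ih₁ h₁
      obtain rfl := hnone rfl
      exact (ih₂ h).imp_left hem.seq_of_skip.trans
    next h₁ =>
      cases h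
      exact ⟨(ih₁ h₁).1.seq_of_skip, nofun⟩
    next h₁ =>
      cases h
      exact ⟨(ih₁ h₁).1.seq t₂, nofun⟩

theorem generates_of_isTrace {t : IntCom} {tr : List ExtCom} {σ : State}
    (h : isTrace t tr σ = true) : Generates t σ tr := by
  induction tr generalizing t σ with
  | nil => exact .nil t σ
  | cons e tr ih =>
    rw [isTrace] at h
    split at h
    · contradiction
    next h₁ =>
      simp only [Bool.and_eq_true, decide_eq_true_eq] at h
      obtain ⟨rfl, h⟩ := h
      exact .emit (evalUntilNextCom_emitsTo h₁).1 (.restart (.refl _) (ih h))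
    next h₁ =>
      simp only [Bool.and_eq_true, decide_eq_true_eq] at h
      obtain ⟨rfl, h⟩ := h
      exact .emit (evalUntilNextCom_emitsTo h₁).1 (ih h)

/-- soundness of the trace decider. -/
theorem isTrace_sound (tr : List ExtCom) (σ : State) (hσ : σ ≠ State.Wrong)
    (h : isTrace spec tr σ = true) : Generates spec σ tr := by
  exact generates_of_isTrace h
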